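/- Let Θ and 𝒴 be measurable spaces, κ a Markov kernel from Θ to 𝒴, and p, q probability measures on Θ with q absolutely continuous with respect to p. If I_aff(q;p) = ∫ KL(κ(θ) ‖ p∘κ) dq(θ) is finite, then |I(q) − I_aff(q;p)| = KL(q∘κ ‖ p∘κ) ≤ KL(q ‖ p), where I(q) = ∫ KL(κ(θ) ‖ q∘κ) dq(θ). -/

import Mathlib

open MeasureTheory ProbabilityTheory Real Classical
open scoped ENNReal

/-- The Kullback–Leibler divergence `KL(μ ‖ ν) = ∫ log (dμ/dν) dμ`, with value `∞`
unless `μ` is absolutely continuous w.r.t. `ν` and the log-likelihood ratio is integrable. -/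
noncomputable def klDiv {α : Type*} [MeasurableSpace α] (μ ν : Measure α) : ℝ≥0∞ :=
  if μ ≪ ν ∧ Integrable (llr μ ν) μ then ENNReal.ofReal (∫ x, llr μ ν x ∂μ) else ⊤

/-- The marginal `q∘κ` on `𝒴` of a prior `q` on `Θ` under the likelihood kernel `κ`,
given by `(q∘κ)(A) = ∫ κ(θ)(A) dq(θ)`. -/
noncomputable def marg {Θ 𝒴 : Type*} [MeasurableSpace Θ] [MeasurableSpace 𝒴]
    (κ : Kernel Θ 𝒴) (q : Measure Θ) : Measure 𝒴 :=
  q.bind κ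

/-- The expected information gain of prior `q`: `I(q) = ∫ KL(κ(θ) ‖ q∘κ) dq(θ)`. -/
noncomputable def EIG {Θ 𝒴 : Type*} [MeasurableSpace Θ] [MeasurableSpace 𝒴]
    (κ : Kernel Θ 𝒴) (q : Measure Θ) : ℝ≥0∞ :=
  ∫⁻ θ, klDiv (κ θ) (marg κ q) ∂q

/-- The affine approximation of the expected information gain at reference prior `p`:
`I_aff(q;p) = ∫ KL(κ(θ) ‖ p∘κ) dq(θ)`. -/
noncomputable def EIGaff {Θ 𝒴 : Type*} [MeasurableSpace Θ] [MeasurableSpace 𝒴]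
    (κ : Kernel Θ 𝒴) (q p : Measure Θ) : ℝ≥0∞ :=
  ∫⁻ θ, klDiv (κ θ) (marg κ p) ∂q

/-- The two divergences differ only by the mass correction, which vanishes here. -/
theorem klDiv_eq_informationTheory_klDiv {α : Type*} [MeasurableSpace α] (μ ν : Measure α)
    [IsProbabilityMeasure μ] [IsProbabilityMeasure ν] :
    klDiv μ ν = InformationTheory.klDiv μ ν := by
  by_cases h : μ ≪ ν ∧ Integrable (llr μ ν) μ
  · rw [klDiv, if_pos h, InformationTheory.klDiv_of_ac_of_integrable h.1 h.2]
    simp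
  · rw [klDiv, if_neg h]
    exact (not_ne_iff.mp (InformationTheory.klDiv_ne_top_iff.not.mpr h)).symm

theorem lintegral_ofReal_neg_llr_ne_top {α : Type*} [MeasurableSpace α] {μ ν : Measure α}
    [IsFiniteMeasure μ] [IsFiniteMeasure ν] (hμν : μ ≪ ν) :
    ∫⁻ x, ENNReal.ofReal (-llr μ ν x) ∂μ ≠ ⊤ := by
  have hm : Measurable fun x ↦ ENNReal.ofReal (-llr μ ν x) :=
    (measurable_llr μ ν).neg.ennreal_ofReal
  rw [← lintegral_rnDeriv_mul hμν hm.aemeasurable]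
  refine ((lintegral_mono_ae (g := fun _ ↦ 1) ?_).trans_lt (by simp)).ne
  filter_upwards [Measure.rnDeriv_lt_top μ ν] with x hx
  have hnn : 0 ≤ (μ.rnDeriv ν x).toReal := ENNReal.toReal_nonneg
  have hkl := InformationTheory.klFun_nonneg hnn
  rw [InformationTheory.klFun_apply] at hkl
  rw [← ENNReal.ofReal_toReal hx.ne, ← ENNReal.ofReal_mul hnn, llr, ENNReal.ofReal_le_one]
  linarith

theorem klDiv_add_lintegral_ofReal_neg_llr {α : Type*} [MeasurableSpace α] {μ ν : Measure α}
    [IsProbabilityMeasure μ] [IsProbabilityMeasure ν] (hμν : μ ≪ ν) :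
    klDiv μ ν + ∫⁻ x, ENNReal.ofReal (-llr μ ν x) ∂μ
      = ∫⁻ x, ENNReal.ofReal (llr μ ν x) ∂μ := by
  have hneg := lintegral_ofReal_neg_llr_ne_top hμν
  by_cases h : Integrable (llr μ ν) μ
  · have hpos : ∫⁻ x, ENNReal.ofReal (llr μ ν x) ∂μ ≠ ⊤ := h.lintegral_lt_top.ne
    have hnonneg : 0 ≤ ∫ x, llr μ ν x ∂μ := by
      simpa using InformationTheory.integral_llr_add_sub_measure_univ_nonneg hμν h
    rw [klDiv, if_pos ⟨hμν, h⟩, ← ENNReal.ofReal_toReal hneg,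
      ← ENNReal.ofReal_add hnonneg ENNReal.toReal_nonneg,
      integral_eq_lintegral_pos_part_sub_lintegral_neg_part h, sub_add_cancel,
      ENNReal.ofReal_toReal hpos]
  · rw [klDiv, if_neg (fun h' ↦ h h'.2), top_add, eq_comm]
    by_contra hpos
    refine h ⟨(measurable_llr μ ν).aestronglyMeasurable, ?_⟩
    have habs (x : α) : ‖llr μ ν x‖ₑ
        = ENNReal.ofReal (llr μ ν x) + ENNReal.ofReal (-llr μ ν x) := by
      rw [Real.enorm_eq_ofReal_abs]
      rcases le_total 0 (llr μ ν x) with hx | hx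
      · simp [abs_of_nonneg hx, ENNReal.ofReal_of_nonpos (neg_nonpos.mpr hx)]
      · simp [abs_of_nonpos hx, ENNReal.ofReal_of_nonpos hx]
    simp_rw [HasFiniteIntegral, habs]
    rw [lintegral_add_left (measurable_llr μ ν).ennreal_ofReal]
    exact ENNReal.add_lt_top.mpr ⟨lt_top_iff_ne_top.mpr hpos, lt_top_iff_ne_top.mpr hneg⟩

theorem absolutelyContinuous_of_ae_rnDeriv_ne_zero {α : Type*} [MeasurableSpace α]
    {μ ν ρ : Measure α} [IsFiniteMeasure ν] [IsFiniteMeasure ρ]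
    (hμρ : μ ≪ ρ) (hνρ : ν ≪ ρ) (hpos : ∀ᵐ x ∂μ, ν.rnDeriv ρ x ≠ 0) : μ ≪ ν := by
  intro s hs
  rw [← Measure.withDensity_rnDeriv_eq ν ρ hνρ,
    withDensity_apply_eq_zero (Measure.measurable_rnDeriv ν ρ)] at hs
  have hs' := hμρ hs
  rw [Set.inter_comm] at hs'
  exact (measure_inter_conull hpos).symm.trans hs'

theorem llr_ae_eq_add_llr {α : Type*} [MeasurableSpace α] {μ ν ρ : Measure α}
    [IsFiniteMeasure μ] [IsFiniteMeasure ν] [IsFiniteMeasure ρ] (hμν : μ ≪ ν) (hνρ : ν ≪ ρ) :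
    llr μ ρ =ᵐ[μ] fun x ↦ llr μ ν x + llr ν ρ x := by
  have hμρ := hμν.trans hνρ
  filter_upwards [hμρ.ae_le (Measure.rnDeriv_mul_rnDeriv hμν (κ := ρ)),
    Measure.rnDeriv_pos hμν, hμν.ae_le (Measure.rnDeriv_lt_top μ ν),
    hμν.ae_le (Measure.rnDeriv_pos hνρ), hμρ.ae_le (Measure.rnDeriv_lt_top ν ρ)]
    with x hx h1 h2 h3 h4
  simp only [llr, ← hx, Pi.mul_apply, ENNReal.toReal_mul]
  exact Real.log_mul (ENNReal.toReal_pos h1.ne' h2.ne).ne' (ENNReal.toReal_pos h3.ne' h4.ne).ne'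

/-- Change of reference measure in the Kullback–Leibler divergence, with the correction
`∫ log (dν/dρ) dμ` split into its positive and negative parts. -/
theorem klDiv_add_lintegral_llr {α : Type*} [MeasurableSpace α] {μ ν ρ : Measure α}
    [IsProbabilityMeasure μ] [IsProbabilityMeasure ν] [IsProbabilityMeasure ρ]
    (hνρ : ν ≪ ρ) (hpos : ∀ᵐ x ∂μ, ν.rnDeriv ρ x ≠ 0) :
    klDiv μ ν + ∫⁻ x, ENNReal.ofReal (llr ν ρ x) ∂μ
      = klDiv μ ρ + ∫⁻ x, ENNReal.ofReal (-llr ν ρ x) ∂μ := by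
  by_cases hμν : μ ≪ ν
  swap
  · have hμρ : ¬ μ ≪ ρ :=
      fun h ↦ hμν (absolutelyContinuous_of_ae_rnDeriv_ne_zero h hνρ hpos)
    simp [klDiv, hμν, hμρ]
  have hμρ := hμν.trans hνρ
  have hm (μ ν : Measure α) : Measurable fun x ↦ ENNReal.ofReal (llr μ ν x) :=
    (measurable_llr μ ν).ennreal_ofReal
  have hm' (μ ν : Measure α) : Measurable fun x ↦ ENNReal.ofReal (-llr μ ν x) :=
    (measurable_llr μ ν).neg.ennreal_ofReal
  have hsplit (a b : ℝ) :
      ENNReal.ofReal (-(a + b)) + (ENNReal.ofReal a + ENNReal.ofReal b)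
        = ENNReal.ofReal (a + b) + (ENNReal.ofReal (-a) + ENNReal.ofReal (-b)) := by
    simp_rw [ENNReal.ofReal, ← ENNReal.coe_add, ENNReal.coe_inj, ← NNReal.coe_inj,
      NNReal.coe_add, Real.coe_toNNReal']
    linarith [max_zero_sub_max_neg_zero_eq_self (a + b), max_zero_sub_max_neg_zero_eq_self a,
      max_zero_sub_max_neg_zero_eq_self b]
  have hint : ∫⁻ x, (ENNReal.ofReal (-llr μ ρ x)
        + (ENNReal.ofReal (llr μ ν x) + ENNReal.ofReal (llr ν ρ x))) ∂μ
      = ∫⁻ x, (ENNReal.ofReal (llr μ ρ x)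
        + (ENNReal.ofReal (-llr μ ν x) + ENNReal.ofReal (-llr ν ρ x))) ∂μ := by
    refine lintegral_congr_ae ?_
    filter_upwards [llr_ae_eq_add_llr hμν hνρ] with x hx
    rw [hx, hsplit]
  rw [lintegral_add_left (hm' μ ρ), lintegral_add_left (hm μ ν), lintegral_add_left (hm μ ρ),
    lintegral_add_left (hm' μ ν), ← klDiv_add_lintegral_ofReal_neg_llr hμν,
    ← klDiv_add_lintegral_ofReal_neg_llr hμρ] at hint
  have hfin := ENNReal.add_ne_top.mpr
    ⟨lintegral_ofReal_neg_llr_ne_top hμρ, lintegral_ofReal_neg_llr_ne_top hμν⟩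
  rw [← ENNReal.add_right_inj hfin]
  convert hint using 1 <;> ring

/-- The compensation identity. The divergences need not be measurable functions of the parameter,
since only the correction terms are required to be. -/
theorem EIG_add_klDiv_marg {Θ 𝒴 : Type*} [MeasurableSpace Θ] [MeasurableSpace 𝒴]
    (κ : Kernel Θ 𝒴) [IsMarkovKernel κ] (p q : Measure Θ)
    [IsProbabilityMeasure p] [IsProbabilityMeasure q] (hqp : q ≪ p) :
    EIG κ q + klDiv (marg κ q) (marg κ p) = EIGaff κ q p := by
  have : IsProbabilityMeasure (marg κ p) := inferInstanceAs (IsProbabilityMeasure (p.bind κ))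
  have : IsProbabilityMeasure (marg κ q) := inferInstanceAs (IsProbabilityMeasure (q.bind κ))
  have hac : marg κ q ≪ marg κ p := hqp.comp_right κ
  have hpos : ∀ᵐ θ ∂q, ∀ᵐ y ∂κ θ, (marg κ q).rnDeriv (marg κ p) y ≠ 0 :=
    Measure.ae_ae_of_ae_comp ((Measure.rnDeriv_pos hac).mono fun _ h ↦ h.ne')
  have hm : Measurable fun y ↦ ENNReal.ofReal (llr (marg κ q) (marg κ p) y) :=
    (measurable_llr _ _).ennreal_ofReal
  have hm' : Measurable fun y ↦ ENNReal.ofReal (-llr (marg κ q) (marg κ p) y) :=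
    (measurable_llr _ _).neg.ennreal_ofReal
  have hint := lintegral_congr_ae (hpos.mono fun θ hθ ↦ klDiv_add_lintegral_llr hac hθ)
  rw [lintegral_add_right _ hm.lintegral_kernel, lintegral_add_right _ hm'.lintegral_kernel,
    ← Measure.lintegral_bind κ.aemeasurable hm.aemeasurable,
    ← Measure.lintegral_bind κ.aemeasurable hm'.aemeasurable] at hint
  change EIG κ q + ∫⁻ y, _ ∂(marg κ q) = EIGaff κ q p + ∫⁻ y, _ ∂(marg κ q) at hint
  rw [← klDiv_add_lintegral_ofReal_neg_llr hac, ← add_assoc] at hint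
  exact (ENNReal.add_left_inj (lintegral_ofReal_neg_llr_ne_top hac)).mp hint

/-- Error bound for the affine EIG approximation: if `I_aff(q;p)` is finite then
`|I(q) − I_aff(q;p)| = KL(q∘κ ‖ p∘κ) ≤ KL(q ‖ p)` (here `I(q) ≤ I_aff(q;p)`, so the
absolute difference is `I_aff(q;p) - I(q)`). -/
theorem abs_eig_sub_eigAff_eq_klDiv_marg
    {Θ 𝒴 : Type*} [MeasurableSpace Θ] [MeasurableSpace 𝒴]
    (κ : Kernel Θ 𝒴) [IsMarkovKernel κ] (p q : Measure Θ)
    [IsProbabilityMeasure p] [IsProbabilityMeasure q] (hqp : q ≪ p)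
    (hfin : EIGaff κ q p ≠ ⊤) :
    EIGaff κ q p - EIG κ q = klDiv (marg κ q) (marg κ p) ∧
    klDiv (marg κ q) (marg κ p) ≤ klDiv q p := by
  have : IsProbabilityMeasure (marg κ p) := inferInstanceAs (IsProbabilityMeasure (p.bind κ))
  have : IsProbabilityMeasure (marg κ q) := inferInstanceAs (IsProbabilityMeasure (q.bind κ))
  have hsum := EIG_add_klDiv_marg κ p q hqp
  refine ⟨?_, ?_⟩
  · have hEIG : EIG κ q ≠ ⊤ := ne_top_of_le_ne_top hfin (hsum ▸ le_self_add)
    rw [← hsum, ENNReal.add_sub_cancel_left hEIG]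
  · rw [klDiv_eq_informationTheory_klDiv, klDiv_eq_informationTheory_klDiv]
    exact InformationTheory.klDiv_comp_right_le q p κ
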